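/- arXiv:1711.03784 — 5 statements merged into one kernel-verified Lean document; each statement's English description precedes it below -/
import Mathlib

section
/- Let C be a Z2Z4-additive cyclic code in Z2^α × Z4^β. Then K(C) is also a Z2Z4-additive cyclic code; that is, K(C) is an additive subgroup of Z2^α × Z4^β and π(K(C)) = K(C). -/
open Polynomial

namespace Z2Z4

variable {α β : ℕ}

/-- The ambient space `ℤ₂^α × ℤ₄^β`. -/
abbrev V (α β : ℕ) := (Fin α → ZMod 2) × (Fin β → ZMod 4)

/-- The binary ambient space `ℤ₂^(α+2β)`, written as a product. -/
abbrev B (α β : ℕ) := (Fin α → ZMod 2) × ((Fin β → ZMod 2) × (Fin β → ZMod 2))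

/-- The double cyclic shift `π(u | u') = (u_{α-1},u_0,…,u_{α-2} | u'_{β-1},u'_0,…,u'_{β-2})`. -/
def shift (v : V α β) : V α β :=
  (fun i => v.1 ((finRotate α).symm i), fun i => v.2 ((finRotate β).symm i))

/-- For `z = t + 2h` with `t,h ∈ {0,1}`, this is `h`. -/
def grayHat (z : ZMod 4) : ZMod 2 := ((z.val / 2 : ℕ) : ZMod 2)

/-- For `z = t + 2h` with `t,h ∈ {0,1}`, this is `t`. -/
def grayTilde (z : ZMod 4) : ZMod 2 := ((z.val % 2 : ℕ) : ZMod 2)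

/-- The Gray map `φ(u') = (û', ũ' + û')`. -/
def phi (u : Fin β → ZMod 4) : (Fin β → ZMod 2) × (Fin β → ZMod 2) :=
  (fun i => grayHat (u i), fun i => grayTilde (u i) + grayHat (u i))

/-- The extended Gray map `Φ(u | u') = (u, φ(u'))`. -/
def Phi (v : V α β) : B α β := (v.1, phi v.2)

/-- `2v*w = (0 | 2(v' * w'))`, componentwise product on the quaternary part. -/
def twoStar (v w : V α β) : V α β := (0, fun i => 2 * v.2 i * w.2 i)

/-- The kernel `K(C) = {v ∈ C : 2v*w ∈ C for all w ∈ C}`. -/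
def K (C : Set (V α β)) : Set (V α β) :=
  {v ∈ C | ∀ w ∈ C, twoStar v w ∈ C}

/-- `R(C) = {v : Φ(v) ∈ ⟨Φ(C)⟩}`. -/
def R (C : Set (V α β)) : Set (V α β) :=
  {v | Phi v ∈ Submodule.span (ZMod 2) (Phi '' C)}

/-- The kernel of a quaternary code `D ⊆ ℤ₄^β`. -/
def KQ (D : Set (Fin β → ZMod 4)) : Set (Fin β → ZMod 4) :=
  {v ∈ D | ∀ w ∈ D, (fun i => 2 * v i * w i) ∈ D}

/-- `R(D) = {v' : φ(v') ∈ ⟨φ(D)⟩}` for a quaternary code `D ⊆ ℤ₄^β`. -/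
def RQ (D : Set (Fin β → ZMod 4)) : Set (Fin β → ZMod 4) :=
  {v | phi v ∈ Submodule.span (ZMod 2) (phi '' D)}

/-- The kernel of a binary code: `{x : x + D = D}`. -/
def kerSet {M : Type*} [AddCommGroup M] (D : Set M) : Set M :=
  {x | (fun d => x + d) '' D = D}

/-- The dimension of the kernel of a binary code. -/
noncomputable def dimKer {M : Type*} [AddCommGroup M] [Module (ZMod 2) M] (D : Set M) : ℕ :=
  Module.finrank (ZMod 2) (Submodule.span (ZMod 2) (kerSet D))

/-- The rank of a binary code: the dimension of its linear span. -/
noncomputable def rankOf {M : Type*} [AddCommGroup M] [Module (ZMod 2) M] (D : Set M) : ℕ :=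
  Module.finrank (ZMod 2) (Submodule.span (ZMod 2) D)

/-- `Φ(S)` is linear (closed under addition). -/
def grayAddClosed (S : Set (V α β)) : Prop :=
  ∀ x ∈ Phi '' S, ∀ y ∈ Phi '' S, x + y ∈ Phi '' S

/-- `φ(D)` is linear (closed under addition), for a quaternary code. -/
def grayAddClosedQ (D : Set (Fin β → ZMod 4)) : Prop :=
  ∀ x ∈ phi '' D, ∀ y ∈ phi '' D, x + y ∈ phi '' D

/-- The modulo-2 reduction `ℤ₄ → ℤ₂`. -/
def red2c : ZMod 4 →+* ZMod 2 := ZMod.castHom (show 2 ∣ 4 by norm_num) (ZMod 2)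

/-- The modulo-2 reduction of a polynomial over `ℤ₄`. -/
noncomputable def red2 : Polynomial (ZMod 4) →+* Polynomial (ZMod 2) := Polynomial.mapRingHom red2c

/-- Scalar multiplication of `c ∈ ℤ₄` on `ℤ₂^α × ℤ₄^β` (mod-2 reduction on the binary part). -/
def smul4 (c : ZMod 4) (v : V α β) : V α β := (red2c c • v.1, c • v.2)

/-- The action of a polynomial `p ∈ ℤ₄[x]`: `p ⋆ v = ∑ p_j • π^j(v)`, which is the
module action of `ℤ₄[x]` on `ℤ₂[x]/(x^α-1) × ℤ₄[x]/(x^β-1)` in vector form. -/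
noncomputable def polyAct (p : Polynomial (ZMod 4)) (v : V α β) : V α β :=
  ∑ j ∈ Finset.range (p.natDegree + 1), smul4 (p.coeff j) (shift^[j] v)

/-- The vector in `ℤ₂^α` corresponding to `p mod (x^α - 1)`. -/
noncomputable def toVec2 (p : Polynomial (ZMod 2)) : Fin α → ZMod 2 :=
  fun i => ∑ j ∈ Finset.range (p.natDegree + 1), if j % α = (i : ℕ) then p.coeff j else 0

/-- The vector in `ℤ₄^β` corresponding to `p mod (x^β - 1)`. -/
noncomputable def toVec4 (p : Polynomial (ZMod 4)) : Fin β → ZMod 4 :=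
  fun i => ∑ j ∈ Finset.range (p.natDegree + 1), if j % β = (i : ℕ) then p.coeff j else 0

/-- The `ℤ₄[x]`-submodule of `R_{α,β}` generated by `(b | 0)` and `(ℓ | a)`, in vector form. -/
def genCode (α β : ℕ) (b ℓ : Polynomial (ZMod 2)) (a : Polynomial (ZMod 4)) : Set (V α β) :=
  {x : V α β | ∃ p q : Polynomial (ZMod 4),
    x = polyAct p (toVec2 b, 0) + polyAct q (toVec2 ℓ, toVec4 a)}

/-- The `ℤ₂ℤ₄`-additive cyclic code `⟨(b | 0), (ℓ | fh + 2f)⟩`. -/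
def stdCode (α β : ℕ) (b ℓ : Polynomial (ZMod 2)) (f h : Polynomial (ZMod 4)) : Set (V α β) :=
  genCode α β b ℓ (f * h + 2 * f)

end Z2Z4

namespace Z2Z4

section

variable {α β : ℕ}

theorem twoStar_shift (v w : V α β) : twoStar (shift v) (shift w) = shift (twoStar v w) := rfl

theorem shift_injective : Function.Injective (shift : V α β → V α β) := by
  intro v w h
  refine Prod.ext (funext fun i => ?_) (funext fun i => ?_)
  · simpa only [shift, Equiv.symm_apply_apply] using
      congrFun (congrArg Prod.fst h) (finRotate α i)
  · simpa only [shift, Equiv.symm_apply_apply] using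
      congrFun (congrArg Prod.snd h) (finRotate β i)

theorem twoStar_zero_left (w : V α β) : twoStar 0 w = 0 := by
  ext i <;> simp [twoStar]

theorem twoStar_add_left (u v w : V α β) :
    twoStar (u + v) w = twoStar u w + twoStar v w := by
  ext i
  · simp [twoStar]
  · simp [twoStar, mul_add, add_mul]

theorem twoStar_neg_left (v w : V α β) : twoStar (-v) w = -twoStar v w := by
  ext i <;> simp [twoStar]

/-- The kernel of an additive code, as an additive subgroup. -/
def kernelSubgroup (C : AddSubgroup (V α β)) : AddSubgroup (V α β) where
  carrier := K (C : Set (V α β))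
  zero_mem' := ⟨C.zero_mem, fun w _ => by
    rw [twoStar_zero_left]
    exact C.zero_mem⟩
  add_mem' := fun hu hv => ⟨C.add_mem hu.1 hv.1, fun w hw => by
    rw [twoStar_add_left]
    exact C.add_mem (hu.2 w hw) (hv.2 w hw)⟩
  neg_mem' := fun hv => ⟨C.neg_mem hv.1, fun w hw => by
    rw [twoStar_neg_left]
    exact C.neg_mem (hv.2 w hw)⟩

/-- The kernel construction commutes with the shift, for an arbitrary set of vectors. -/
theorem shift_image_K (C : Set (V α β)) : shift '' K C = K (shift '' C) := by
  ext x
  constructor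
  · rintro ⟨v, ⟨hv, hvC⟩, rfl⟩
    refine ⟨⟨v, hv, rfl⟩, ?_⟩
    rintro _ ⟨w, hw, rfl⟩
    exact ⟨twoStar v w, hvC w hw, rfl⟩
  · rintro ⟨⟨v, hv, rfl⟩, hvC⟩
    refine ⟨v, ⟨hv, fun w hw => ?_⟩, rfl⟩
    have h := hvC (shift w) ⟨w, hw, rfl⟩
    rwa [twoStar_shift, shift_injective.mem_set_image] at h

end

/-- If `C` is a `ℤ₂ℤ₄`-additive cyclic code, then `K(C)` is also a
`ℤ₂ℤ₄`-additive cyclic code: it is an additive subgroup and is invariant under the shift. -/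
theorem kernel_of_cyclic_is_cyclic (α β : ℕ) (C : AddSubgroup (V α β))
    (hcyc : shift '' (C : Set (V α β)) = (C : Set (V α β))) :
    (∃ D : AddSubgroup (V α β), (D : Set (V α β)) = K (C : Set (V α β))) ∧
      shift '' K (C : Set (V α β)) = K (C : Set (V α β)) :=
  ⟨⟨kernelSubgroup C, rfl⟩, by rw [shift_image_K, hcyc]⟩

end Z2Z4
end

section
/- Let C be a Z2Z4-additive cyclic code in Z2^α × Z4^β. Then R(C) is also a Z2Z4-additive cyclic code; that is, R(C) is an additive subgroup of Z2^α × Z4^β and π(R(C)) = R(C). -/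
open Polynomial

namespace Z2Z4

/-- The bilinear map `B × B → B` that sends `(Φ v, Φ w)` to `Φ (2v*w)`. -/
def carry (α β : ℕ) : B α β →ₗ[ZMod 2] B α β →ₗ[ZMod 2] B α β :=
  LinearMap.mk₂ (ZMod 2)
    (fun x y => (0, (x.2.1 + x.2.2) * (y.2.1 + y.2.2), (x.2.1 + x.2.2) * (y.2.1 + y.2.2)))
    (fun x x' y => by ext <;> simp <;> ring)
    (fun c x y => by ext <;> simp <;> ring)
    (fun x y y' => by ext <;> simp <;> ring)
    (fun c x y => by ext <;> simp <;> ring)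

theorem Phi_add {α β : ℕ} (v w : V α β) :
    Phi (v + w) = Phi v + Phi w + carry α β (Phi v) (Phi w) := by
  have hHat : ∀ a b : ZMod 4, grayHat (a + b) = grayHat a + grayHat b +
      (grayHat a + (grayTilde a + grayHat a)) * (grayHat b + (grayTilde b + grayHat b)) := by
    decide
  have hSum : ∀ a b : ZMod 4, grayTilde (a + b) + grayHat (a + b) =
      (grayTilde a + grayHat a) + (grayTilde b + grayHat b) +
      (grayHat a + (grayTilde a + grayHat a)) * (grayHat b + (grayTilde b + grayHat b)) := by
    decide
  ext i
  · simp [Phi, carry]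
  · exact hHat _ _
  · exact hSum _ _

theorem carry_mem_span {α β : ℕ} (C : AddSubgroup (V α β)) {x y : B α β}
    (hx : x ∈ Submodule.span (ZMod 2) (Phi '' (C : Set (V α β))))
    (hy : y ∈ Submodule.span (ZMod 2) (Phi '' (C : Set (V α β)))) :
    carry α β x y ∈ Submodule.span (ZMod 2) (Phi '' (C : Set (V α β))) := by
  refine Submodule.map₂_le.1 ?_ x hx y hy
  rw [Submodule.map₂_span_span, Submodule.span_le]
  rintro _ ⟨_, ⟨v, hv, rfl⟩, _, ⟨w, hw, rfl⟩, rfl⟩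
  change carry α β (Phi v) (Phi w) ∈ Submodule.span (ZMod 2) (Phi '' (C : Set (V α β)))
  rw [eq_sub_of_add_eq' (Phi_add v w).symm]
  have hmem : ∀ u ∈ C, Phi u ∈ Submodule.span (ZMod 2) (Phi '' (C : Set (V α β))) :=
    fun u hu => Submodule.subset_span ⟨u, hu, rfl⟩
  exact sub_mem (hmem _ (add_mem hv hw)) (add_mem (hmem v hv) (hmem w hw))

/-- The code `R(C)` of an additive code `C`, as an additive subgroup. -/
def rankSubgroup {α β : ℕ} (C : AddSubgroup (V α β)) : AddSubgroup (V α β) :=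
  let M : AddSubmonoid (V α β) :=
    { carrier := R (C : Set (V α β))
      zero_mem' := Submodule.subset_span ⟨0, C.zero_mem, rfl⟩
      add_mem' := fun {v w} hv hw => by
        change Phi (v + w) ∈ Submodule.span (ZMod 2) (Phi '' (C : Set (V α β)))
        rw [Phi_add]
        exact add_mem (add_mem hv hw) (carry_mem_span C hv hw) }
  { M with
    neg_mem' := fun {v} hv => by
      have h3 : -v = 3 • v := by
        have hZ2 : ∀ a : ZMod 2, -a = 3 * a := by decide
        have hZ4 : ∀ a : ZMod 4, -a = 3 * a := by decide
        ext i
        · simpa using hZ2 (v.1 i)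
        · simpa using hZ4 (v.2 i)
      rw [h3]
      exact M.nsmul_mem hv 3 }

/-- The cyclic shift on the binary space that corresponds to `shift` under the Gray map. -/
def binaryShift (α β : ℕ) : B α β ≃ₗ[ZMod 2] B α β :=
  (LinearEquiv.funCongrLeft (ZMod 2) (ZMod 2) (finRotate α).symm).prodCongr
    ((LinearEquiv.funCongrLeft (ZMod 2) (ZMod 2) (finRotate β).symm).prodCongr
      (LinearEquiv.funCongrLeft (ZMod 2) (ZMod 2) (finRotate β).symm))

theorem Phi_shift {α β : ℕ} (v : V α β) : Phi (shift v) = binaryShift α β (Phi v) := rfl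

theorem shift_surjective {α β : ℕ} : Function.Surjective (shift (α := α) (β := β)) := fun v =>
  ⟨(fun i => v.1 (finRotate α i), fun i => v.2 (finRotate β i)), by
    simp only [shift, Equiv.apply_symm_apply]⟩

theorem shift_mem_R_iff {α β : ℕ} {C : Set (V α β)} (hcyc : shift '' C = C) {v : V α β} :
    shift v ∈ R C ↔ v ∈ R C := by
  have hspan : (Submodule.span (ZMod 2) (Phi '' C)).map (binaryShift α β).toLinearMap =
      Submodule.span (ZMod 2) (Phi '' C) := by
    conv_rhs => rw [← hcyc]
    rw [Submodule.map_span, Set.image_image, Set.image_image]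
    rfl
  change Phi (shift v) ∈ Submodule.span (ZMod 2) (Phi '' C) ↔ _
  rw [← hspan, Phi_shift]
  exact (binaryShift α β).injective.mem_set_image

/-- If `C` is a `ℤ₂ℤ₄`-additive cyclic code, then `R(C)` is also a
`ℤ₂ℤ₄`-additive cyclic code: it is an additive subgroup and is invariant under the shift. -/
theorem rank_code_of_cyclic_is_cyclic (α β : ℕ) (C : AddSubgroup (V α β))
    (hcyc : shift '' (C : Set (V α β)) = (C : Set (V α β))) :
    (∃ D : AddSubgroup (V α β), (D : Set (V α β)) = R (C : Set (V α β))) ∧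
      shift '' R (C : Set (V α β)) = R (C : Set (V α β)) := by
  refine ⟨⟨rankSubgroup C, rfl⟩, ?_⟩
  have hpre : shift ⁻¹' R (C : Set (V α β)) = R (C : Set (V α β)) :=
    Set.ext fun _ => shift_mem_R_iff hcyc
  conv_lhs => rw [← hpre]
  exact Set.image_preimage_eq _ shift_surjective

end Z2Z4
end

section
/- Let C be a Z2Z4-additive code in Z2^α × Z4^β. Then the projection of R(C) onto the Z4 coordinates equals R(C_Y); that is, R(C)_Y = R(C_Y). -/
open Polynomial

namespace Z2Z4

/-- The span of the Gray image of a projected code is the projection of the span of its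
extended Gray image. -/
theorem span_phi_image_snd {α β : ℕ} (C : Set (V α β)) :
    Submodule.span (ZMod 2) (phi '' (Prod.snd '' C)) =
      (Submodule.span (ZMod 2) (Phi '' C)).map (LinearMap.snd (ZMod 2) _ _) := by
  rw [Submodule.map_span, Set.image_image, Set.image_image]
  rfl

/-- For a `ℤ₂ℤ₄`-additive code `C`, the projection of `R(C)` onto the
`ℤ₄` coordinates equals `R(C_Y)`. -/
theorem rank_proj_eq (α β : ℕ) (C : AddSubgroup (V α β)) :
    Prod.snd '' R (C : Set (V α β)) = RQ (Prod.snd '' (C : Set (V α β))) := by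
  ext v
  simp only [RQ, R, Set.mem_ofPred_eq, span_phi_image_snd, Submodule.mem_map, Set.mem_image,
    LinearMap.snd_apply]
  constructor
  · rintro ⟨w, hw, rfl⟩
    exact ⟨Phi w, hw, rfl⟩
  · rintro ⟨⟨u, _⟩, hx, rfl⟩
    exact ⟨(u, v), hx, rfl⟩

end Z2Z4
end

section
/- Let C be a Z2Z4-additive code in Z2^α × Z4^β and let κ1 be the Z2-dimension of the subspace {v ∈ Z2^α : (v | 0) ∈ C}. Then dim(ker(Φ(C))) ≤ κ1 + dim(ker(φ(C_Y))). -/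
open Polynomial

namespace Z2Z4

/-- The kernel of a binary code is already a linear subspace. -/
theorem span_kerSet_subset {M : Type*} [AddCommGroup M] [Module (ZMod 2) M] (D : Set M) :
    (Submodule.span (ZMod 2) (kerSet D) : Set M) ⊆ kerSet D := by
  have zero_mem : (0 : M) ∈ kerSet D := by simp [kerSet]
  intro x hx
  induction hx using Submodule.span_induction with
  | mem x hx => exact hx
  | zero => exact zero_mem
  | add x y _ _ hx hy =>
    change (fun d => x + y + d) '' D = D
    calc (fun d => x + y + d) '' D = (fun d => x + d) '' ((fun d => y + d) '' D) := by
          simp only [Set.image_image, add_assoc]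
      _ = D := by rw [show (fun d => y + d) '' D = D from hy, show (fun d => x + d) '' D = D from hx]
  | smul c x _ hx =>
    obtain rfl | rfl : c = 0 ∨ c = 1 := by revert c; decide
    · simpa using zero_mem
    · simpa using hx

theorem kerSet_image_subset {M N : Type*} [AddCommGroup M] [AddCommGroup N] (f : M →+ N)
    (D : Set M) : f '' kerSet D ⊆ kerSet (f '' D) := by
  rintro _ ⟨x, hx, rfl⟩
  change (fun d => f x + d) '' (f '' D) = f '' D
  conv_rhs => rw [← show (fun d => x + d) '' D = D from hx]
  simp only [Set.image_image, map_add]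

theorem kerSet_subset_of_zero_mem {M : Type*} [AddCommGroup M] {D : Set M} (h : (0 : M) ∈ D) :
    kerSet D ⊆ D := by
  intro x hx
  rw [← show (fun d => x + d) '' D = D from hx]
  exact ⟨0, h, add_zero x⟩

/-- Rank-nullity for a linear map restricted to a subspace `P`. -/
theorem finrank_le_finrank_add_of_map_le {k M N : Type*} [Field k] [AddCommGroup M] [Module k M]
    [FiniteDimensional k M] [AddCommGroup N] [Module k N] [FiniteDimensional k N]
    (f : M →ₗ[k] N) (P K : Submodule k M) (Q : Submodule k N)
    (hK : P ⊓ LinearMap.ker f ≤ K) (hQ : P.map f ≤ Q) :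
    Module.finrank k P ≤ Module.finrank k K + Module.finrank k Q := by
  have hrange : Module.finrank k (LinearMap.range (f.domRestrict P)) ≤ Module.finrank k Q := by
    rw [LinearMap.range_domRestrict]
    exact Submodule.finrank_mono hQ
  have hker : Module.finrank k (LinearMap.ker (f.domRestrict P)) ≤ Module.finrank k K := by
    rw [← Submodule.finrank_map_subtype_eq P (LinearMap.ker (f.domRestrict P))]
    refine Submodule.finrank_mono (le_trans ?_ hK)
    rintro _ ⟨x, hx, rfl⟩
    exact ⟨x.2, hx⟩
  have := LinearMap.finrank_range_add_finrank_ker (f.domRestrict P)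
  omega

theorem phi_eq_zero_iff {u : Fin β → ZMod 4} : phi u = 0 ↔ u = 0 := by
  have key : ∀ z : ZMod 4, grayHat z = 0 ∧ grayTilde z + grayHat z = 0 ↔ z = 0 := by
    unfold grayHat grayTilde
    decide
  simp only [phi, Prod.ext_iff, funext_iff, Prod.fst_zero, Prod.snd_zero, Pi.zero_apply,
    ← forall_and, key]

theorem snd_image_Phi_image (C : Set (V α β)) :
    Prod.snd '' (Phi '' C) = phi '' (Prod.snd '' C) := by
  simp [Set.image_image, Phi]

/-- For a `ℤ₂ℤ₄`-additive code `C`, with `κ₁` the dimension of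
`{v : (v | 0) ∈ C}`, one has `dim ker Φ(C) ≤ κ₁ + dim ker φ(C_Y)`. -/
theorem dimKer_le_kappa1_add (α β : ℕ) (C : AddSubgroup (V α β)) :
    dimKer (Phi '' (C : Set (V α β))) ≤
      Module.finrank (ZMod 2)
          (Submodule.span (ZMod 2)
            {v : Fin α → ZMod 2 | ((v, (0 : Fin β → ZMod 4)) : V α β) ∈ C}) +
        dimKer (phi '' (Prod.snd '' (C : Set (V α β)))) := by
  refine (finrank_le_finrank_add_of_map_le (LinearMap.snd (ZMod 2) _ _) _
    ((Submodule.span (ZMod 2) {v : Fin α → ZMod 2 | (v, (0 : Fin β → ZMod 4)) ∈ C}).map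
      (LinearMap.inl (ZMod 2) _ _)) _ ?_ ?_).trans
    (Nat.add_le_add_right (Submodule.finrank_map_le _ _) _)
  · rintro x ⟨hx, hx0 : x.2 = 0⟩
    have zero_mem : (0 : B α β) ∈ Phi '' (C : Set (V α β)) :=
      ⟨0, C.zero_mem, Prod.ext rfl (phi_eq_zero_iff.2 rfl)⟩
    obtain ⟨⟨v, u⟩, hc, rfl⟩ := kerSet_subset_of_zero_mem zero_mem (span_kerSet_subset _ hx)
    obtain rfl : u = 0 := phi_eq_zero_iff.1 hx0
    exact ⟨v, Submodule.subset_span hc, Prod.ext rfl hx0.symm⟩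
  · rw [Submodule.map_span, ← snd_image_Phi_image]
    exact Submodule.span_mono (kerSet_image_subset
      (AddMonoidHom.snd (Fin α → ZMod 2) ((Fin β → ZMod 2) × (Fin β → ZMod 2))) _)

end Z2Z4
end

section
/- Let C be a Z2Z4-additive cyclic code in Z2^α × Z4^β and let κ1 be the Z2-dimension of the subspace {v ∈ Z2^α : (v | 0) ∈ C}. Then rank(Φ(C)) ≥ κ1 + rank(φ(C_Y)). -/
open Polynomial

namespace Z2Z4

/-- Rank–nullity for the second projection of a subspace `W` of a product: a subspace `U` embedded
in `W` along the first factor lies in the kernel of that projection. -/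
theorem finrank_add_finrank_map_snd_le {k M N : Type*} [Field k] [AddCommGroup M] [Module k M]
    [AddCommGroup N] [Module k N] [FiniteDimensional k M] [FiniteDimensional k N]
    {U : Submodule k M} {W : Submodule k (M × N)} (h : U.map (LinearMap.inl k M N) ≤ W) :
    Module.finrank k U + Module.finrank k (W.map (LinearMap.snd k M N)) ≤ Module.finrank k W := by
  have hker : ∀ u : U, (LinearMap.inl k M N u) ∈ W := fun u => h ⟨u, u.2, rfl⟩
  let g : U →ₗ[k] LinearMap.ker ((LinearMap.snd k M N).domRestrict W) :=
    (((LinearMap.inl k M N).comp U.subtype).codRestrict W hker).codRestrict _ fun _ => rfl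
  have hg : Function.Injective g := fun x y hxy =>
    Subtype.ext (congrArg (fun z => z.1.1.1) hxy)
  have hle := LinearMap.finrank_le_finrank_of_injective hg
  have hrn := LinearMap.finrank_range_add_finrank_ker ((LinearMap.snd k M N).domRestrict W)
  rw [LinearMap.range_domRestrict] at hrn
  omega

theorem phi_zero : phi (0 : Fin β → ZMod 4) = 0 := by
  ext i <;> simp [phi, grayHat, grayTilde]

/-- For a `ℤ₂ℤ₄`-additive cyclic code `C`, with `κ₁` the dimension of
`{v : (v | 0) ∈ C}`, one has `rank Φ(C) ≥ κ₁ + rank φ(C_Y)`. -/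
theorem rank_ge_kappa1_add (α β : ℕ) (C : AddSubgroup (V α β))
    (hcyc : shift '' (C : Set (V α β)) = (C : Set (V α β))) :
    Module.finrank (ZMod 2)
        (Submodule.span (ZMod 2)
          {v : Fin α → ZMod 2 | ((v, (0 : Fin β → ZMod 4)) : V α β) ∈ C}) +
      rankOf (phi '' (Prod.snd '' (C : Set (V α β)))) ≤
        rankOf (Phi '' (C : Set (V α β))) := by
  have hmap : (Submodule.span (ZMod 2) (Phi '' (C : Set (V α β)))).map
      (LinearMap.snd (ZMod 2) (Fin α → ZMod 2) ((Fin β → ZMod 2) × (Fin β → ZMod 2))) =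
      Submodule.span (ZMod 2) (phi '' (Prod.snd '' (C : Set (V α β)))) := by
    rw [Submodule.map_span, Set.image_image, Set.image_image]
    rfl
  unfold rankOf
  rw [← hmap]
  refine finrank_add_finrank_map_snd_le ?_
  rw [Submodule.map_span]
  refine Submodule.span_mono ?_
  rintro _ ⟨v, hv, rfl⟩
  exact ⟨(v, 0), hv, Prod.ext rfl phi_zero⟩

end Z2Z4
end
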